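/- Let $(X_1, C_1, u_1)$ and $(X_2, C_2, u_2)$ be order unit spaces with strictly positive states $\varphi_1, \varphi_2$ and cross sections $\Sigma_i = \{x \in C_i^\circ : \varphi_i(x) = 1\}$. A map $f : (\Sigma_1, d_H) \to (\Sigma_2, d_H)$ is an isometry that maps line segments to line segments if and only if $f$ is a projective linear homomorphism, i.e., there exists a bi-positive linear map $T : X_1 \to X_2$ such that $f(x) = Tx / \varphi_2(Tx)$ for all $x \in \Sigma_1$. -/

import Mathlib

namespace HilbertGeom

/-- An order unit space: a real vector space with an Archimedean cone `C` and order unit `u`. -/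
structure OrderUnitSpace (X : Type*) [AddCommGroup X] [Module ℝ X] where
  C : Set X
  u : X
  convex : Convex ℝ C
  smul_mem : ∀ ⦃c : ℝ⦄, 0 ≤ c → ∀ ⦃x : X⦄, x ∈ C → c • x ∈ C
  salient : ∀ ⦃x : X⦄, x ∈ C → -x ∈ C → x = 0
  archimedean : ∀ x y : X, y ∈ C → (∀ n : ℕ, 0 < n → y - (n : ℝ) • x ∈ C) → -x ∈ C
  u_mem : u ∈ C
  orderUnit : ∀ x : X, ∃ c : ℝ, 0 < c ∧ c • u - x ∈ C

namespace OrderUnitSpace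

variable {X : Type*} [AddCommGroup X] [Module ℝ X] (S : OrderUnitSpace X)

/-- The order unit norm `‖x‖_u = inf {c > 0 : -c•u ≤ x ≤ c•u}`. -/
noncomputable def onorm (x : X) : ℝ :=
  sInf {c : ℝ | 0 < c ∧ c • S.u - x ∈ S.C ∧ c • S.u + x ∈ S.C}

/-- The interior of the cone `C` with respect to the order unit norm. -/
def interiorC : Set X :=
  {x : X | ∃ ε > 0, ∀ y : X, S.onorm (y - x) < ε → y ∈ S.C}

/-- `M(x/y) = inf {β > 0 : x ≤_C β y}`. -/
noncomputable def M (x y : X) : ℝ := sInf {c : ℝ | 0 < c ∧ c • y - x ∈ S.C}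

/-- Birkhoff's version of Hilbert's metric. -/
noncomputable def dH (x y : X) : ℝ := Real.log (S.M x y * S.M y x)

/-- `φ` is a state: a linear functional with `φ u = 1`. -/
def IsState (φ : X →ₗ[ℝ] ℝ) : Prop := φ S.u = 1

/-- `φ` is strictly positive: `φ(C \ {0}) ⊆ (0, ∞)`. -/
def StrictlyPos (φ : X →ₗ[ℝ] ℝ) : Prop := ∀ x ∈ S.C, x ≠ 0 → 0 < φ x

/-- The cross section `Σ_φ = {x ∈ C° : φ x = 1}`. -/
def Sig (φ : X →ₗ[ℝ] ℝ) : Set X := {x | x ∈ S.interiorC ∧ φ x = 1}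

/-- `z` lies in the closure of `A` with respect to the order unit norm. -/
def InClosure (A : Set X) (z : X) : Prop := ∀ ε > 0, ∃ w ∈ A, S.onorm (w - z) < ε

/-- The relative boundary of `Σ_φ` (in the affine hyperplane `φ = 1`, w.r.t. the order
unit norm): since `Σ_φ` is relatively open this is its closure minus itself. -/
def relBoundary (φ : X →ₗ[ℝ] ℝ) : Set X :=
  {z : X | S.InClosure (S.Sig φ) z ∧ z ∉ S.Sig φ}

/-- The straight line through `x` and `y`. -/
def lineThrough (x y : X) : Set X := {z : X | ∃ t : ℝ, z = x + t • (y - x)}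

end OrderUnitSpace

end HilbertGeom

namespace HilbertGeom

namespace OrderUnitSpace

section Cone

variable {X : Type*} [AddCommGroup X] [Module ℝ X] {S : OrderUnitSpace X}

lemma add_mem {x y : X} (hx : x ∈ S.C) (hy : y ∈ S.C) : x + y ∈ S.C := by
  have h := S.smul_mem (c := 2) (by norm_num)
    (S.convex hx hy (a := 1 / 2) (b := 1 / 2) (by norm_num) (by norm_num) (by norm_num))
  have e : (2 : ℝ) • (((1 : ℝ) / 2) • x + ((1 : ℝ) / 2) • y) = x + y := by module
  rwa [e] at h

lemma smul_mem_iff {c : ℝ} (hc : 0 < c) {x : X} : c • x ∈ S.C ↔ x ∈ S.C := by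
  refine ⟨fun h => ?_, fun h => S.smul_mem hc.le h⟩
  have := S.smul_mem (inv_pos.2 hc).le h
  rwa [inv_smul_smul₀ hc.ne'] at this

lemma mem_interiorC_iff {x : X} : x ∈ S.interiorC ↔ ∃ ε : ℝ, 0 < ε ∧ x - ε • S.u ∈ S.C := by
  constructor
  · rintro ⟨ε, hε, h⟩
    refine ⟨ε / 2, half_pos hε, h _ ?_⟩
    refine lt_of_le_of_lt (csInf_le ⟨0, fun c hc => hc.1.le⟩ ⟨half_pos hε, ?_, ?_⟩)
      (half_lt_self hε)
    · have e : (ε / 2) • S.u - (x - (ε / 2) • S.u - x) = ε • S.u := by module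
      rw [e]
      exact S.smul_mem hε.le S.u_mem
    · have e : (ε / 2) • S.u + (x - (ε / 2) • S.u - x) = (0 : ℝ) • S.u := by module
      rw [e]
      exact S.smul_mem le_rfl S.u_mem
  · rintro ⟨ε, hε, h⟩
    refine ⟨ε, hε, fun y hy => ?_⟩
    have hne : {c : ℝ | 0 < c ∧ c • S.u - (y - x) ∈ S.C ∧ c • S.u + (y - x) ∈ S.C}.Nonempty := by
      obtain ⟨a, ha, ha'⟩ := S.orderUnit (y - x)
      obtain ⟨b, hb, hb'⟩ := S.orderUnit (-(y - x))
      refine ⟨a + b, add_pos ha hb, ?_, ?_⟩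
      · have e : (a + b) • S.u - (y - x) = (a • S.u - (y - x)) + b • S.u := by module
        rw [e]
        exact add_mem ha' (S.smul_mem hb.le S.u_mem)
      · have e : (a + b) • S.u + (y - x) = (b • S.u - -(y - x)) + a • S.u := by module
        rw [e]
        exact add_mem hb' (S.smul_mem ha.le S.u_mem)
    obtain ⟨c, ⟨-, -, hc⟩, hcε⟩ := exists_lt_of_csInf_lt hne hy
    have e : y = (c • S.u + (y - x)) + ((x - ε • S.u) + (ε - c) • S.u) := by module
    rw [e]
    exact add_mem hc (add_mem h (S.smul_mem (sub_pos.2 hcε).le S.u_mem))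

lemma interiorC_subset {x : X} (hx : x ∈ S.interiorC) : x ∈ S.C := by
  obtain ⟨ε, hε, h⟩ := mem_interiorC_iff.1 hx
  have := add_mem h (S.smul_mem hε.le S.u_mem)
  rwa [sub_add_cancel] at this

lemma u_mem_interiorC : S.u ∈ S.interiorC := by
  refine mem_interiorC_iff.2 ⟨1, one_pos, ?_⟩
  have e : S.u - (1 : ℝ) • S.u = (0 : ℝ) • S.u := by module
  rw [e]
  exact S.smul_mem le_rfl S.u_mem

lemma smul_mem_interiorC {c : ℝ} (hc : 0 < c) {x : X} (hx : x ∈ S.interiorC) :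
    c • x ∈ S.interiorC := by
  obtain ⟨ε, hε, h⟩ := mem_interiorC_iff.1 hx
  refine mem_interiorC_iff.2 ⟨c * ε, mul_pos hc hε, ?_⟩
  rw [mul_smul, ← smul_sub]
  exact S.smul_mem hc.le h

lemma add_mem_interiorC {x y : X} (hx : x ∈ S.interiorC) (hy : y ∈ S.C) :
    x + y ∈ S.interiorC := by
  obtain ⟨ε, hε, h⟩ := mem_interiorC_iff.1 hx
  refine mem_interiorC_iff.2 ⟨ε, hε, ?_⟩
  rw [add_sub_right_comm]
  exact add_mem h hy

lemma exists_add_smul_mem_interiorC (x : X) : ∃ c : ℝ, 0 < c ∧ x + c • S.u ∈ S.interiorC := by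
  obtain ⟨c, hc, h⟩ := S.orderUnit (-x)
  refine ⟨c + 1, by linarith, ?_⟩
  have e : x + (c + 1) • S.u = S.u + (c • S.u - -x) := by module
  rw [e]
  exact add_mem_interiorC u_mem_interiorC h

variable {φ : X →ₗ[ℝ] ℝ}

lemma StrictlyPos.nonneg (hφ : S.StrictlyPos φ) {x : X} (hx : x ∈ S.C) : 0 ≤ φ x := by
  by_cases h : x = 0
  · simp [h]
  · exact (hφ x hx h).le

lemma StrictlyPos.pos (hφ : S.StrictlyPos φ) (hs : S.IsState φ) {x : X}
    (hx : x ∈ S.interiorC) : 0 < φ x := by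
  obtain ⟨ε, hε, h⟩ := mem_interiorC_iff.1 hx
  have h1 := hφ.nonneg h
  have h2 : φ S.u = 1 := hs
  simp only [map_sub, map_smul, h2, smul_eq_mul, mul_one] at h1
  linarith

section

variable (hφ : S.StrictlyPos φ) (hs : S.IsState φ)
include hφ hs

lemma ne_zero_of_mem_interiorC {x : X} (hx : x ∈ S.interiorC) : x ≠ 0 := by
  rintro rfl
  simpa using hφ.pos hs hx

lemma div_le_of_smul_sub_mem {x y : X} (hy : y ∈ S.interiorC) {c : ℝ}
    (h : c • y - x ∈ S.C) : φ x / φ y ≤ c := by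
  have := hφ.nonneg h
  simp only [map_sub, map_smul, smul_eq_mul, sub_nonneg] at this
  exact (div_le_iff₀ (hφ.pos hs hy)).2 this

lemma M_spec {x y : X} (hx : x ∈ S.interiorC) (hy : y ∈ S.interiorC) :
    0 < S.M x y ∧ ∀ c : ℝ, c • y - x ∈ S.C ↔ S.M x y ≤ c := by
  have hq : 0 < φ x / φ y := div_pos (hφ.pos hs hx) (hφ.pos hs hy)
  have hne : {c : ℝ | 0 < c ∧ c • y - x ∈ S.C}.Nonempty := by
    obtain ⟨ε, hε, h⟩ := mem_interiorC_iff.1 hy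
    obtain ⟨c, hc, h'⟩ := S.orderUnit x
    refine ⟨c / ε, div_pos hc hε, ?_⟩
    have e : (c / ε) • y - x = (c / ε) • (y - ε • S.u) + (c • S.u - x) := by
      match_scalars <;> field_simp
      ring
    rw [e]
    exact add_mem (S.smul_mem (div_pos hc hε).le h) h'
  have hpos : 0 < S.M x y :=
    hq.trans_le (le_csInf hne fun c hc => div_le_of_smul_sub_mem hφ hs hy hc.2)
  refine ⟨hpos, fun c => ⟨fun h => ?_, fun h => ?_⟩⟩
  · exact csInf_le ⟨0, fun c hc => hc.1.le⟩
      ⟨hq.trans_le (div_le_of_smul_sub_mem hφ hs hy h), h⟩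
  · have key := S.archimedean (x - c • y) y (interiorC_subset hy) fun n hn => by
      have hn' : (0 : ℝ) < n := Nat.cast_pos.2 hn
      obtain ⟨d, ⟨-, hd⟩, hdc⟩ := exists_lt_of_csInf_lt hne
        (lt_of_le_of_lt h (lt_add_of_pos_right c (inv_pos.2 hn')))
      have e : y - (n : ℝ) • (x - c • y) =
          (n : ℝ) • ((d • y - x) + (c + (n : ℝ)⁻¹ - d) • y) := by
        match_scalars <;> field_simp
        ring
      rw [e]
      exact S.smul_mem hn'.le (add_mem hd (S.smul_mem (sub_pos.2 hdc).le (interiorC_subset hy)))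
    rwa [neg_sub] at key

lemma M_pos {x y : X} (hx : x ∈ S.interiorC) (hy : y ∈ S.interiorC) : 0 < S.M x y :=
  (M_spec hφ hs hx hy).1

lemma smul_sub_mem_iff {x y : X} (hx : x ∈ S.interiorC) (hy : y ∈ S.interiorC) {c : ℝ} :
    c • y - x ∈ S.C ↔ S.M x y ≤ c :=
  (M_spec hφ hs hx hy).2 c

lemma sub_smul_mem_iff {x y : X} (hx : x ∈ S.interiorC) (hy : y ∈ S.interiorC) {c : ℝ} :
    x - c • y ∈ S.C ↔ c ≤ (S.M y x)⁻¹ := by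
  have hM := M_pos hφ hs hy hx
  rcases le_or_gt c 0 with hc | hc
  · refine iff_of_true ?_ (hc.trans (inv_pos.2 hM).le)
    have e : x - c • y = x + (-c) • y := by module
    rw [e]
    exact add_mem (interiorC_subset hx) (S.smul_mem (neg_nonneg.2 hc) (interiorC_subset hy))
  · rw [le_inv_comm₀ hc hM, ← smul_sub_mem_iff hφ hs hy hx, ← smul_mem_iff hc (x := c⁻¹ • x - y),
      smul_sub,
      smul_inv_smul₀ hc.ne']

lemma M_smul_left {x y : X} (hx : x ∈ S.interiorC) (hy : y ∈ S.interiorC) {c : ℝ}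
    (hc : 0 < c) : S.M (c • x) y = c * S.M x y := by
  refine eq_of_forall_ge_iff fun t => ?_
  rw [← smul_sub_mem_iff hφ hs (smul_mem_interiorC hc hx) hy, ← le_div_iff₀' hc,
    ← smul_sub_mem_iff hφ hs hx hy, ← smul_mem_iff (S := S) hc (x := (t / c) • y - x)]
  have e : c • ((t / c) • y - x) = t • y - c • x := by
    match_scalars <;> field_simp
  rw [e]

lemma M_smul_right {x y : X} (hx : x ∈ S.interiorC) (hy : y ∈ S.interiorC) {c : ℝ}
    (hc : 0 < c) : S.M x (c • y) = c⁻¹ * S.M x y := by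
  refine eq_of_forall_ge_iff fun t => ?_
  rw [← smul_sub_mem_iff hφ hs hx (smul_mem_interiorC hc hy), inv_mul_le_iff₀ hc,
    ← smul_sub_mem_iff hφ hs hx hy, smul_smul, mul_comm]

lemma M_self {x : X} (hx : x ∈ S.interiorC) : S.M x x = 1 := by
  refine eq_of_forall_ge_iff fun t => ?_
  rw [← smul_sub_mem_iff hφ hs hx hx]
  constructor
  · intro h
    simpa [(hφ.pos hs hx).ne'] using div_le_of_smul_sub_mem hφ hs hx h
  · intro h
    have e : t • x - x = (t - 1) • x := by module
    rw [e]
    exact S.smul_mem (sub_nonneg.2 h) (interiorC_subset hx)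

lemma M_smul_mul_M_smul {x y : X} (hx : x ∈ S.interiorC) (hy : y ∈ S.interiorC) {a b : ℝ}
    (ha : 0 < a) (hb : 0 < b) :
    S.M (a • x) (b • y) * S.M (b • y) (a • x) = S.M x y * S.M y x := by
  rw [M_smul_left hφ hs hx (smul_mem_interiorC hb hy) ha, M_smul_right hφ hs hx hy hb,
    M_smul_left hφ hs hy (smul_mem_interiorC ha hx) hb, M_smul_right hφ hs hy hx ha]
  field_simp

lemma eq_smul_of_M_mul_M_eq_one {x y : X} (hx : x ∈ S.interiorC) (hy : y ∈ S.interiorC)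
    (h : S.M x y * S.M y x = 1) : x = S.M x y • y := by
  have h1 := (smul_sub_mem_iff hφ hs hx hy).2 le_rfl
  have h2 := (sub_smul_mem_iff hφ hs hx hy).2 (eq_inv_of_mul_eq_one_left h).le
  have := S.salient h2 (by rwa [neg_sub])
  exact sub_eq_zero.1 this

lemma M_smul_add_smul {v x : X} (hv : v ∈ S.interiorC) (hx : x ∈ S.interiorC) {a b : ℝ}
    (hb : 0 ≤ b) (h : a • v + b • x ∈ S.interiorC) :
    S.M (a • v + b • x) v = a + b * S.M x v ∧
      (S.M v (a • v + b • x))⁻¹ = a + b * (S.M v x)⁻¹ := by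
  rcases hb.eq_or_lt with rfl | hb
  · rw [zero_smul, add_zero] at h ⊢
    have ha : 0 < a := by
      have := hφ.pos hs h
      rw [map_smul, smul_eq_mul] at this
      exact pos_of_mul_pos_left this (hφ.pos hs hv).le
    rw [M_smul_left hφ hs hv hv ha, M_smul_right hφ hs hv hv ha, M_self hφ hs hv]
    simp
  · constructor
    · refine eq_of_forall_ge_iff fun t => ?_
      rw [← smul_sub_mem_iff hφ hs h hv, ← le_sub_iff_add_le', ← le_div_iff₀' hb,
        ← smul_sub_mem_iff hφ hs hx hv, ← smul_mem_iff hb (x := ((t - a) / b) • v - x)]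
      have e : b • (((t - a) / b) • v - x) = t • v - (a • v + b • x) := by
        match_scalars <;> field_simp
      rw [e]
    · refine eq_of_forall_le_iff fun t => ?_
      rw [← sub_smul_mem_iff hφ hs h hv, ← sub_le_iff_le_add', ← div_le_iff₀' hb,
        ← sub_smul_mem_iff hφ hs hx hv, ← smul_mem_iff hb (x := x - ((t - a) / b) • v)]
      have e : b • (x - ((t - a) / b) • v) = a • v + b • x - t • v := by
        match_scalars <;> field_simp
        ring
      rw [e]

lemma M_smul_add_neg_smul {v x : X} (hv : v ∈ S.interiorC) (hx : x ∈ S.interiorC) {a b : ℝ}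
    (hb : 0 < b) (h : a • v + (-b) • x ∈ S.interiorC) :
    S.M (a • v + (-b) • x) v = a - b * (S.M v x)⁻¹ ∧
      (S.M v (a • v + (-b) • x))⁻¹ = a - b * S.M x v := by
  constructor
  · refine eq_of_forall_ge_iff fun t => ?_
    rw [← smul_sub_mem_iff hφ hs h hv, sub_le_comm, ← div_le_iff₀' hb,
      ← sub_smul_mem_iff hφ hs hx hv, ← smul_mem_iff hb (x := x - ((a - t) / b) • v)]
    have e : b • (x - ((a - t) / b) • v) = t • v - (a • v + (-b) • x) := by
      match_scalars <;> field_simp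
      ring
    rw [e]
  · refine eq_of_forall_le_iff fun t => ?_
    rw [← sub_smul_mem_iff hφ hs h hv, le_sub_comm, ← le_div_iff₀' hb,
      ← smul_sub_mem_iff hφ hs hx hv, ← smul_mem_iff hb (x := ((a - t) / b) • v - x)]
    have e : b • (((a - t) / b) • v - x) = a • v + (-b) • x - t • v := by
      match_scalars <;> field_simp
    rw [e]

lemma inv_M_ne_M {v x : X} (hv : v ∈ S.interiorC) (hx : x ∈ S.interiorC)
    (h : ¬ ∃ a : ℝ, x = a • v) : (S.M v x)⁻¹ ≠ S.M x v := fun e =>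
  h ⟨_, eq_smul_of_M_mul_M_eq_one hφ hs hx hv <| by
    rw [← e, inv_mul_cancel₀ (M_pos hφ hs hv hx).ne']⟩

end

end Cone

section Normalize

variable {X : Type*} [AddCommGroup X] [Module ℝ X] {S : OrderUnitSpace X} {φ : X →ₗ[ℝ] ℝ}

lemma inv_smul_mem_segment {x y z : X} (hx : 0 < φ x) (hy : 0 < φ y) (hz : 0 < φ z) {a b : ℝ}
    (ha : 0 ≤ a) (hb : 0 ≤ b) (h : z = a • x + b • y) :
    (φ z)⁻¹ • z ∈ segment ℝ ((φ x)⁻¹ • x) ((φ y)⁻¹ • y) := by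
  refine ⟨a * φ x / φ z, b * φ y / φ z, by positivity, by positivity, ?_, ?_⟩
  · have e : φ z = a * φ x + b * φ y := by simp [h]
    rw [← add_div, ← e, div_self hz.ne']
  · nth_rewrite 4 [h]
    match_scalars <;> field_simp

lemma exists_smul_add_smul_of_inv_smul_mem_segment {x y z : X} (hx : 0 < φ x) (hy : 0 < φ y)
    (hz : 0 < φ z) (h : (φ z)⁻¹ • z ∈ segment ℝ ((φ x)⁻¹ • x) ((φ y)⁻¹ • y)) :
    ∃ a b : ℝ, 0 ≤ a ∧ 0 ≤ b ∧ z = a • x + b • y := by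
  obtain ⟨a, b, ha, hb, -, e⟩ := h
  refine ⟨φ z * a / φ x, φ z * b / φ y, by positivity, by positivity, ?_⟩
  calc z = φ z • (φ z)⁻¹ • z := (smul_inv_smul₀ hz.ne' z).symm
    _ = _ := by
      rw [← e]
      match_scalars <;> field_simp

lemma inv_smul_mem_Sig (hφ : S.StrictlyPos φ) (hs : S.IsState φ) {x : X}
    (hx : x ∈ S.interiorC) : (φ x)⁻¹ • x ∈ S.Sig φ := by
  have h := hφ.pos hs hx
  refine ⟨smul_mem_interiorC (inv_pos.2 h) hx, ?_⟩
  rw [map_smul, smul_eq_mul, inv_mul_cancel₀ h.ne']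

lemma segment_subset_Sig {x y : X} (hx : x ∈ S.Sig φ) (hy : y ∈ S.Sig φ) :
    segment ℝ x y ⊆ S.Sig φ := by
  rintro _ ⟨a, b, ha, hb, hab, rfl⟩
  refine ⟨?_, by simp [hx.2, hy.2, hab]⟩
  rcases ha.eq_or_lt with rfl | ha
  · have : b = 1 := by linarith
    simpa [this] using hy.1
  · exact add_mem_interiorC (smul_mem_interiorC ha hx.1)
      (S.smul_mem hb (interiorC_subset hy.1))

end Normalize

variable {X₁ : Type*} [AddCommGroup X₁] [Module ℝ X₁] {X₂ : Type*} [AddCommGroup X₂] [Module ℝ X₂]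

/-- A positively homogeneous map between the interiors of the cones which preserves Hilbert's
metric, maps two-dimensional subcones onto two-dimensional subcones, and preserves the function
`x ↦ M(u/x)`, where the image of the order unit plays the role of `u` in the codomain. -/
structure IsConeIsometry (S₁ : OrderUnitSpace X₁) (S₂ : OrderUnitSpace X₂) (F : X₁ → X₂) :
    Prop where
  mem : ∀ {x}, x ∈ S₁.interiorC → F x ∈ S₂.interiorC
  map_smul : ∀ {c : ℝ}, 0 < c → ∀ {x}, x ∈ S₁.interiorC → F (c • x) = c • F x
  M_mul_M : ∀ {x}, x ∈ S₁.interiorC → ∀ {y}, y ∈ S₁.interiorC →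
    S₂.M (F x) (F y) * S₂.M (F y) (F x) = S₁.M x y * S₁.M y x
  M_unit_left : ∀ {x}, x ∈ S₁.interiorC → S₂.M (F S₁.u) (F x) = S₁.M S₁.u x
  exists_map_add : ∀ {x}, x ∈ S₁.interiorC → ∀ {y}, y ∈ S₁.interiorC →
    ∃ a b : ℝ, 0 ≤ a ∧ 0 ≤ b ∧ F (x + y) = a • F x + b • F y
  exists_of_map_eq : ∀ {x}, x ∈ S₁.interiorC → ∀ {y}, y ∈ S₁.interiorC →
    ∀ {z}, z ∈ S₁.interiorC → ∀ {a b : ℝ}, 0 ≤ a → 0 ≤ b → F z = a • F x + b • F y →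
    ∃ s r : ℝ, 0 ≤ s ∧ 0 ≤ r ∧ z = s • x + r • y

namespace IsConeIsometry

variable {S₁ : OrderUnitSpace X₁} {S₂ : OrderUnitSpace X₂} {F : X₁ → X₂}
  {φ₁ : X₁ →ₗ[ℝ] ℝ} {φ₂ : X₂ →ₗ[ℝ] ℝ}
  (h : IsConeIsometry S₁ S₂ F)
  (hφ₁ : S₁.StrictlyPos φ₁) (hs₁ : S₁.IsState φ₁) (hφ₂ : S₂.StrictlyPos φ₂) (hs₂ : S₂.IsState φ₂)

include h

lemma map_smul_unit {c : ℝ} (hc : 0 < c) : F (c • S₁.u) = c • F S₁.u :=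
  h.map_smul hc u_mem_interiorC

include hφ₁ hs₁

lemma M_unit_right {x : X₁} (hx : x ∈ S₁.interiorC) : S₂.M (F x) (F S₁.u) = S₁.M x S₁.u := by
  have := h.M_mul_M hx u_mem_interiorC
  rw [h.M_unit_left hx] at this
  exact mul_right_cancel₀ (M_pos hφ₁ hs₁ u_mem_interiorC hx).ne' this

include hφ₂ hs₂

lemma injOn : Set.InjOn F S₁.interiorC := by
  intro x hx y hy e
  have hM := h.M_mul_M hx hy
  rw [e, M_self hφ₂ hs₂ (h.mem hy), one_mul] at hM
  have hxy := eq_smul_of_M_mul_M_eq_one hφ₁ hs₁ hx hy hM.symm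
  have hF := h.map_smul (M_pos hφ₁ hs₁ hx hy) hy
  rw [← hxy, e] at hF
  have h1 : (1 - S₁.M x y) • F y = 0 := by
    rw [sub_smul, one_smul, ← hF, sub_self]
  have h2 : S₁.M x y = 1 := by
    have := (smul_eq_zero.1 h1).resolve_right (ne_zero_of_mem_interiorC hφ₂ hs₂ (h.mem hy))
    linarith
  rw [hxy, h2, one_smul]

lemma not_exists_map_eq_smul {x : X₁} (hx : x ∈ S₁.interiorC) (hux : ¬ ∃ a : ℝ, x = a • S₁.u) :
    ¬ ∃ a : ℝ, F x = a • F S₁.u := by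
  rintro ⟨a, ha⟩
  have hu : S₁.u ∈ S₁.interiorC := u_mem_interiorC
  have hpos := hφ₂.pos hs₂ (h.mem hx)
  rw [ha, _root_.map_smul, smul_eq_mul] at hpos
  have ha' : 0 < a := pos_of_mul_pos_left hpos (hφ₂.pos hs₂ (h.mem hu)).le
  rw [← h.map_smul_unit ha'] at ha
  exact hux ⟨a, h.injOn hφ₁ hs₁ hφ₂ hs₂ hx (smul_mem_interiorC ha' hu) ha⟩

lemma map_unit_add {x : X₁} (hx : x ∈ S₁.interiorC) : F (S₁.u + x) = F S₁.u + F x := by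
  have hu : S₁.u ∈ S₁.interiorC := u_mem_interiorC
  by_cases hux : ∃ a : ℝ, x = a • S₁.u
  · obtain ⟨a, rfl⟩ := hux
    have hpos := hφ₁.pos hs₁ hx
    rw [_root_.map_smul, smul_eq_mul] at hpos
    have ha : 0 < a := pos_of_mul_pos_left hpos (hφ₁.pos hs₁ hu).le
    have e : S₁.u + a • S₁.u = (1 + a) • S₁.u := by module
    rw [e, h.map_smul_unit ha, h.map_smul_unit (by linarith)]
    module
  · have hux' := add_mem_interiorC hu (interiorC_subset hx)
    obtain ⟨a, b, ha, hb, e⟩ := h.exists_map_add hu hx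
    have h1 := h.M_unit_right hφ₁ hs₁ hux'
    have h2 := h.M_unit_left hux'
    have hF := h.mem hux'
    rw [e] at hF h1 h2
    have e' : S₁.u + x = (1 : ℝ) • S₁.u + (1 : ℝ) • x := by module
    rw [e'] at h1 h2 hux'
    obtain ⟨h3, h4⟩ := M_smul_add_smul hφ₁ hs₁ hu hx zero_le_one hux'
    obtain ⟨h5, h6⟩ := M_smul_add_smul hφ₂ hs₂ (h.mem hu) (h.mem hx) hb hF
    rw [h5, h3, h.M_unit_right hφ₁ hs₁ hx] at h1
    rw [h2, h4, h.M_unit_left hx] at h6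
    have hne := inv_M_ne_M hφ₁ hs₁ hu hx hux
    have hb1 : b = 1 := by
      have : (b - 1) * ((S₁.M S₁.u x)⁻¹ - S₁.M x S₁.u) = 0 := by linear_combination h6.symm - h1
      rcases mul_eq_zero.1 this with h7 | h7
      · linarith
      · exact absurd (sub_eq_zero.1 h7) hne
    subst hb1
    have ha1 : a = 1 := by linarith
    rw [e, ha1, one_smul, one_smul]

lemma map_smul_unit_add_of_nonneg {x : X₁} (hx : x ∈ S₁.interiorC) {a : ℝ} (ha : 0 ≤ a) :
    F (a • S₁.u + x) = a • F S₁.u + F x := by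
  rcases ha.eq_or_lt with rfl | ha
  · simp
  · have hx' := smul_mem_interiorC (inv_pos.2 ha) hx
    have e : a • S₁.u + x = a • (S₁.u + a⁻¹ • x) := by
      rw [smul_add, smul_inv_smul₀ ha.ne']
    rw [e, h.map_smul ha (add_mem_interiorC u_mem_interiorC (interiorC_subset hx')),
      h.map_unit_add hφ₁ hs₁ hφ₂ hs₂ hx', h.map_smul (inv_pos.2 ha) hx, smul_add,
      smul_inv_smul₀ ha.ne']

lemma map_smul_unit_add {x : X₁} (hx : x ∈ S₁.interiorC) {a : ℝ}
    (hax : a • S₁.u + x ∈ S₁.interiorC) : F (a • S₁.u + x) = a • F S₁.u + F x := by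
  rcases le_total 0 a with ha | ha
  · exact h.map_smul_unit_add_of_nonneg hφ₁ hs₁ hφ₂ hs₂ hx ha
  · have := h.map_smul_unit_add_of_nonneg hφ₁ hs₁ hφ₂ hs₂ hax (neg_nonneg.2 ha)
    have e : -a • S₁.u + (a • S₁.u + x) = x := by module
    rw [e] at this
    rw [this]
    module

/-- Additivity when the images of `u`, `x` and `y` are linearly independent. -/
lemma map_add_of_independent {x y : X₁} (hx : x ∈ S₁.interiorC) (hy : y ∈ S₁.interiorC)
    (hux : ¬ ∃ a : ℝ, F x = a • F S₁.u)
    (huxy : ¬ ∃ a b : ℝ, F y = a • F S₁.u + b • F x) : F (x + y) = F x + F y := by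
  have hu : S₁.u ∈ S₁.interiorC := u_mem_interiorC
  have key : ∀ a b c : ℝ, a • F S₁.u + b • F x + c • F y = 0 → a = 0 ∧ b = 0 ∧ c = 0 := by
    intro a b c e
    have hc : c = 0 := by
      by_contra hc
      refine huxy ⟨-a / c, -b / c, ?_⟩
      have e' : F y = c⁻¹ • (a • F S₁.u + b • F x + c • F y) +
          ((-a / c) • F S₁.u + (-b / c) • F x) := by
        match_scalars <;> field_simp <;> ring
      rwa [e, smul_zero, zero_add] at e'
    subst hc
    rw [zero_smul, add_zero] at e
    have hb : b = 0 := by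
      by_contra hb
      refine hux ⟨-a / b, ?_⟩
      have e' : F x = b⁻¹ • (a • F S₁.u + b • F x) + (-a / b) • F S₁.u := by
        match_scalars <;> field_simp
        ring
      rwa [e, smul_zero, zero_add] at e'
    subst hb
    rw [zero_smul, add_zero] at e
    exact ⟨(smul_eq_zero.1 e).resolve_right (ne_zero_of_mem_interiorC hφ₂ hs₂ (h.mem hu)),
      rfl, rfl⟩
  obtain ⟨a, b, -, -, e⟩ := h.exists_map_add hx hy
  obtain ⟨a₁, b₁, -, -, e₁⟩ :=
    h.exists_map_add hx (add_mem_interiorC hu (interiorC_subset hy))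
  obtain ⟨a₂, b₂, -, -, e₂⟩ :=
    h.exists_map_add hy (add_mem_interiorC hu (interiorC_subset hx))
  have e₀ := h.map_unit_add hφ₁ hs₁ hφ₂ hs₂ (add_mem_interiorC hx (interiorC_subset hy))
  rw [h.map_unit_add hφ₁ hs₁ hφ₂ hs₂ hy, add_left_comm, e₀, e] at e₁
  rw [h.map_unit_add hφ₁ hs₁ hφ₂ hs₂ hx, add_left_comm, add_comm y x, e₀, e] at e₂
  obtain ⟨h1, -, h2⟩ := key (1 - b₁) (a - a₁) (b - b₁) <| by
    rw [← sub_eq_zero] at e₁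
    rw [← e₁]
    module
  obtain ⟨h3, h4, -⟩ := key (1 - b₂) (a - b₂) (b - a₂) <| by
    rw [← sub_eq_zero] at e₂
    rw [← e₂]
    module
  rw [e, show a = 1 by linarith, show b = 1 by linarith, one_smul, one_smul]

lemma map_add_of_dependent_nonneg {x y : X₁} (hx : x ∈ S₁.interiorC) (hy : y ∈ S₁.interiorC)
    {a b : ℝ} (hb : 0 ≤ b) (e : F y = a • F S₁.u + b • F x) : F (x + y) = F x + F y := by
  have hu : S₁.u ∈ S₁.interiorC := u_mem_interiorC
  rcases hb.eq_or_lt with rfl | hb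
  · rw [zero_smul, add_zero] at e
    have hpos := hφ₂.pos hs₂ (h.mem hy)
    rw [e, _root_.map_smul, smul_eq_mul] at hpos
    have ha : 0 < a := pos_of_mul_pos_left hpos (hφ₂.pos hs₂ (h.mem hu)).le
    rw [← h.map_smul_unit ha] at e
    rw [h.injOn hφ₁ hs₁ hφ₂ hs₂ hy (smul_mem_interiorC ha hu) e, add_comm x,
      h.map_smul_unit_add_of_nonneg hφ₁ hs₁ hφ₂ hs₂ hx ha.le, h.map_smul_unit ha, add_comm]
  · have hbx := smul_mem_interiorC hb hx
    have ha : 0 ≤ |a| + a := by linarith [neg_abs_le a]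
    have h1 := h.map_smul_unit_add_of_nonneg hφ₁ hs₁ hφ₂ hs₂ hy (abs_nonneg a)
    have h2 := h.map_smul_unit_add_of_nonneg hφ₁ hs₁ hφ₂ hs₂ hbx ha
    have h3 : |a| • S₁.u + y = (|a| + a) • S₁.u + b • x := by
      refine h.injOn hφ₁ hs₁ hφ₂ hs₂ ?_ ?_ ?_
      · rw [add_comm]
        exact add_mem_interiorC hy (S₁.smul_mem (abs_nonneg a) S₁.u_mem)
      · rw [add_comm]
        exact add_mem_interiorC hbx (S₁.smul_mem ha S₁.u_mem)
      · rw [h1, h2, e, h.map_smul hb hx]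
        module
    have h4 : x + y = a • S₁.u + (1 + b) • x := by
      have : y = a • S₁.u + b • x := by
        rw [add_smul, add_assoc] at h3
        exact add_left_cancel h3
      rw [this]
      module
    have h5 := add_mem_interiorC hx (interiorC_subset hy)
    have h6 : 0 < 1 + b := by linarith
    rw [h4] at h5 ⊢
    rw [h.map_smul_unit_add hφ₁ hs₁ hφ₂ hs₂ (smul_mem_interiorC h6 hx) h5, h.map_smul h6 hx, e]
    module

lemma map_add_of_unit_eq {x y : X₁} (hx : x ∈ S₁.interiorC) (hy : y ∈ S₁.interiorC) {s r : ℝ}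
    (hs : 0 < s) (hsr : r ≤ s) (e : S₁.u = s • x + r • y)
    (e' : F S₁.u = s • F x + r • F y) : F (x + y) = F x + F y := by
  have hxy := add_mem_interiorC hx (interiorC_subset hy)
  have h1 : s • (x + y) = S₁.u + (s - r) • y := by
    rw [e]
    module
  have h2 : s • F (x + y) = F S₁.u + (s - r) • F y := by
    rw [← h.map_smul hs hxy, h1]
    rcases hsr.eq_or_lt with rfl | hsr
    · simp
    · have hsr := sub_pos.2 hsr
      rw [h.map_unit_add hφ₁ hs₁ hφ₂ hs₂ (smul_mem_interiorC hsr hy), h.map_smul hsr hy]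
  refine smul_right_injective X₂ hs.ne' ?_
  simp only [h2, e']
  module

lemma map_add_of_dependent_neg {x y : X₁} (hx : x ∈ S₁.interiorC) (hy : y ∈ S₁.interiorC)
    (hux : ¬ ∃ a : ℝ, x = a • S₁.u)
    {a b : ℝ} (hb : 0 < b) (e : F y = a • F S₁.u + (-b) • F x) : F (x + y) = F x + F y := by
  have hu : S₁.u ∈ S₁.interiorC := u_mem_interiorC
  have ha : 0 < a := by
    have h1 := hφ₂.pos hs₂ (h.mem hy)
    have h2 := mul_pos hb (hφ₂.pos hs₂ (h.mem hx))
    rw [e] at h1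
    simp only [_root_.map_add, _root_.map_smul, smul_eq_mul] at h1
    exact pos_of_mul_pos_left (by linarith) (hφ₂.pos hs₂ (h.mem hu)).le
  obtain ⟨s, r, hs, hr, h1⟩ := h.exists_of_map_eq hx hy hu (a := b / a) (b := 1 / a)
    (by positivity) (by positivity) (by rw [e]; match_scalars <;> field_simp; ring)
  have hs' : 0 < s := by
    refine hs.lt_of_ne' fun hs0 => ?_
    rw [hs0, zero_smul, zero_add] at h1
    have hr : 0 < r := hr.lt_of_ne' fun hr => ne_zero_of_mem_interiorC hφ₁ hs₁ hu (by simp [h1, hr])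
    have h2 : F S₁.u = r • F y := by rw [h1, h.map_smul hr hy]
    refine h.not_exists_map_eq_smul hφ₁ hs₁ hφ₂ hs₂ hx hux ⟨(a - r⁻¹) / b, ?_⟩
    have h3 : F y = r⁻¹ • F S₁.u := by rw [h2, inv_smul_smul₀ hr.ne']
    have h4 : F x = b⁻¹ • (a • F S₁.u - (a • F S₁.u + (-b) • F x)) := by
      match_scalars <;> field_simp
      ring
    rw [← e, h3] at h4
    rw [h4]
    match_scalars
    field_simp
  have hr' : 0 < r := hr.lt_of_ne' fun hr0 => hux ⟨s⁻¹, by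
    rw [h1, hr0, zero_smul, add_zero, inv_smul_smul₀ hs'.ne']⟩
  have hyx : y = (1 / r) • S₁.u + (-(s / r)) • x := by
    rw [h1]
    match_scalars <;> field_simp
    ring
  have hy1 := hy
  have hFy := h.mem hy
  have h2 := h.M_unit_right hφ₁ hs₁ hy
  have h3 := h.M_unit_left hy
  rw [e] at hFy h2 h3
  rw [hyx] at h2 h3 hy1
  have hsr : 0 < s / r := by positivity
  obtain ⟨h4, h5⟩ := M_smul_add_neg_smul hφ₁ hs₁ hu hx hsr hy1
  obtain ⟨h6, h7⟩ := M_smul_add_neg_smul hφ₂ hs₂ (h.mem hu) (h.mem hx) hb hFy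
  rw [h6, h4, h.M_unit_left hx] at h2
  rw [h3, h5, h.M_unit_right hφ₁ hs₁ hx] at h7
  have hne := inv_M_ne_M hφ₁ hs₁ hu hx hux
  have hb1 : b = s / r := by
    have : (b - s / r) * ((S₁.M S₁.u x)⁻¹ - S₁.M x S₁.u) = 0 := by linear_combination h7.symm - h2
    rcases mul_eq_zero.1 this with h8 | h8
    · linarith
    · exact absurd (sub_eq_zero.1 h8) hne
  subst hb1
  have ha1 : a = 1 / r := by linarith
  subst ha1
  have e' : F S₁.u = s • F x + r • F y := by
    rw [e]
    match_scalars <;> field_simp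
    ring
  rcases le_total r s with hle | hle
  · exact h.map_add_of_unit_eq hφ₁ hs₁ hφ₂ hs₂ hx hy hs' hle h1 e'
  · rw [add_comm] at h1 e'
    rw [add_comm x, add_comm (F x)]
    exact h.map_add_of_unit_eq hφ₁ hs₁ hφ₂ hs₂ hy hx hr' hle h1 e'

lemma map_add {x y : X₁} (hx : x ∈ S₁.interiorC) (hy : y ∈ S₁.interiorC) :
    F (x + y) = F x + F y := by
  by_cases hux : ∃ a : ℝ, x = a • S₁.u
  · obtain ⟨a, rfl⟩ := hux
    have hu : S₁.u ∈ S₁.interiorC := u_mem_interiorC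
    have hpos := hφ₁.pos hs₁ hx
    rw [_root_.map_smul, smul_eq_mul] at hpos
    have ha : 0 < a := pos_of_mul_pos_left hpos (hφ₁.pos hs₁ hu).le
    rw [h.map_smul_unit_add_of_nonneg hφ₁ hs₁ hφ₂ hs₂ hy ha.le, h.map_smul_unit ha]
  · by_cases huxy : ∃ a b : ℝ, F y = a • F S₁.u + b • F x
    · obtain ⟨a, b, e⟩ := huxy
      rcases le_or_gt 0 b with hb | hb
      · exact h.map_add_of_dependent_nonneg hφ₁ hs₁ hφ₂ hs₂ hx hy hb e
      · exact h.map_add_of_dependent_neg hφ₁ hs₁ hφ₂ hs₂ hx hy hux (neg_pos.2 hb)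
          (by rw [neg_neg, e])
    · exact h.map_add_of_independent hφ₁ hs₁ hφ₂ hs₂ hx hy
        (h.not_exists_map_eq_smul hφ₁ hs₁ hφ₂ hs₂ hx hux) huxy

lemma exists_linearMap : ∃ T : X₁ →ₗ[ℝ] X₂, (∀ x, T x ∈ S₂.C ↔ x ∈ S₁.C) ∧
    ∀ x ∈ S₁.interiorC, T x = F x := by
  have hu : S₁.u ∈ S₁.interiorC := u_mem_interiorC
  choose c hc hmem using exists_add_smul_mem_interiorC (S := S₁)
  have hcu : ∀ x, c x • S₁.u ∈ S₁.interiorC := fun x => smul_mem_interiorC (hc x) hu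
  have hadd : ∀ {x y : X₁}, x ∈ S₁.interiorC → y ∈ S₁.interiorC → F (x + y) = F x + F y :=
    fun hx hy => h.map_add hφ₁ hs₁ hφ₂ hs₂ hx hy
  have hsub : ∀ {z x y : X₁}, x ∈ S₁.interiorC → y ∈ S₁.interiorC → z = x - y →
      F (z + c z • S₁.u) - F (c z • S₁.u) = F x - F y := fun {z x y} hx hy e => by
    have e' : z + c z • S₁.u + y = x + c z • S₁.u := by
      rw [e]
      abel
    rw [sub_eq_sub_iff_add_eq_add, ← hadd (hmem z) hy, e', hadd hx (hcu z)]
  let T : X₁ →ₗ[ℝ] X₂ :=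
    { toFun := fun z => F (z + c z • S₁.u) - F (c z • S₁.u)
      map_add' := fun z w => by
        rw [hsub (add_mem_interiorC (hmem z) (interiorC_subset (hmem w)))
          (add_mem_interiorC (hcu z) (interiorC_subset (hcu w))) (by abel),
          hadd (hmem z) (hmem w), hadd (hcu z) (hcu w)]
        abel
      map_smul' := fun t z => by
        rw [RingHom.id_apply]
        rcases lt_trichotomy t 0 with ht | rfl | ht
        · have ht := neg_pos.2 ht
          rw [hsub (smul_mem_interiorC ht (hcu z)) (smul_mem_interiorC ht (hmem z)) (by module),
            h.map_smul ht (hcu z), h.map_smul ht (hmem z)]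
          module
        · rw [hsub hu hu (by simp)]
          simp
        · rw [hsub (smul_mem_interiorC ht (hmem z)) (smul_mem_interiorC ht (hcu z)) (by module),
            h.map_smul ht (hcu z), h.map_smul ht (hmem z)]
          module }
  refine ⟨T, fun z => ?_, fun x hx => ?_⟩
  · change F (z + c z • S₁.u) - F (c z • S₁.u) ∈ S₂.C ↔ z ∈ S₁.C
    rw [h.map_smul_unit (hc z), sub_smul_mem_iff hφ₂ hs₂ (h.mem (hmem z)) (h.mem hu),
      h.M_unit_left (hmem z), ← sub_smul_mem_iff hφ₁ hs₁ (hmem z) hu, add_sub_cancel_right]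
  · change F (x + c x • S₁.u) - F (c x • S₁.u) = F x
    rw [hadd hx (hcu x), add_sub_cancel_right]

end IsConeIsometry

variable {S₁ : OrderUnitSpace X₁} {S₂ : OrderUnitSpace X₂} {φ₁ : X₁ →ₗ[ℝ] ℝ} {φ₂ : X₂ →ₗ[ℝ] ℝ}

lemma dH_eq_iff (hφ₁ : S₁.StrictlyPos φ₁) (hs₁ : S₁.IsState φ₁) (hφ₂ : S₂.StrictlyPos φ₂)
    (hs₂ : S₂.IsState φ₂) {x y : X₁} {x' y' : X₂} (hx : x ∈ S₁.interiorC)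
    (hy : y ∈ S₁.interiorC) (hx' : x' ∈ S₂.interiorC) (hy' : y' ∈ S₂.interiorC) :
    S₂.dH x' y' = S₁.dH x y ↔ S₂.M x' y' * S₂.M y' x' = S₁.M x y * S₁.M y x :=
  Real.log_injOn_pos.eq_iff
    (mul_pos (M_pos hφ₂ hs₂ hx' hy') (M_pos hφ₂ hs₂ hy' hx'))
    (mul_pos (M_pos hφ₁ hs₁ hx hy) (M_pos hφ₁ hs₁ hy hx))

/-- The positively homogeneous extension of `f`, rescaled so that `x ↦ M(u/x)` is preserved. -/
noncomputable def coneExtension (S₁ : OrderUnitSpace X₁) (S₂ : OrderUnitSpace X₂)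
    (φ₁ : X₁ →ₗ[ℝ] ℝ) (f : X₁ → X₂) (x : X₁) : X₂ :=
  (S₂.M (f S₁.u) (f ((φ₁ x)⁻¹ • x)) / S₁.M S₁.u x) • f ((φ₁ x)⁻¹ • x)

section Extension

variable (hφ₁ : S₁.StrictlyPos φ₁) (hs₁ : S₁.IsState φ₁) (hφ₂ : S₂.StrictlyPos φ₂)
  (hs₂ : S₂.IsState φ₂) {f : X₁ → X₂} (hmaps : Set.MapsTo f (S₁.Sig φ₁) (S₂.Sig φ₂))
include hφ₁ hs₁ hφ₂ hs₂ hmaps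

lemma exists_coneExtension_eq {x : X₁} (hx : x ∈ S₁.interiorC) :
    ∃ r : ℝ, 0 < r ∧ coneExtension S₁ S₂ φ₁ f x = r • f ((φ₁ x)⁻¹ • x) :=
  ⟨_, div_pos (M_pos hφ₂ hs₂ (hmaps ⟨u_mem_interiorC, hs₁⟩).1
    (hmaps (inv_smul_mem_Sig hφ₁ hs₁ hx)).1) (M_pos hφ₁ hs₁ u_mem_interiorC hx), rfl⟩

lemma inv_smul_coneExtension {x : X₁} (hx : x ∈ S₁.interiorC) :
    (φ₂ (coneExtension S₁ S₂ φ₁ f x))⁻¹ • coneExtension S₁ S₂ φ₁ f x = f ((φ₁ x)⁻¹ • x) := by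
  obtain ⟨r, hr, e⟩ := exists_coneExtension_eq hφ₁ hs₁ hφ₂ hs₂ hmaps hx
  rw [e, map_smul, (hmaps (inv_smul_mem_Sig hφ₁ hs₁ hx)).2, smul_eq_mul, mul_one,
    inv_smul_smul₀ hr.ne']

lemma coneExtension_mem {x : X₁} (hx : x ∈ S₁.interiorC) :
    coneExtension S₁ S₂ φ₁ f x ∈ S₂.interiorC := by
  obtain ⟨r, hr, e⟩ := exists_coneExtension_eq hφ₁ hs₁ hφ₂ hs₂ hmaps hx
  rw [e]
  exact smul_mem_interiorC hr (hmaps (inv_smul_mem_Sig hφ₁ hs₁ hx)).1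

lemma isConeIsometry_coneExtension
    (hiso : ∀ x ∈ S₁.Sig φ₁, ∀ y ∈ S₁.Sig φ₁, S₂.dH (f x) (f y) = S₁.dH x y)
    (hseg : ∀ x ∈ S₁.Sig φ₁, ∀ y ∈ S₁.Sig φ₁, f '' segment ℝ x y = segment ℝ (f x) (f y)) :
    IsConeIsometry S₁ S₂ (coneExtension S₁ S₂ φ₁ f) := by
  have hu : S₁.u ∈ S₁.interiorC := u_mem_interiorC
  have huS : S₁.u ∈ S₁.Sig φ₁ := ⟨hu, hs₁⟩
  have hn : ∀ {x}, x ∈ S₁.interiorC → (φ₁ x)⁻¹ • x ∈ S₁.Sig φ₁ := inv_smul_mem_Sig hφ₁ hs₁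
  have hM : ∀ {x}, x ∈ S₁.Sig φ₁ → ∀ {y}, y ∈ S₁.Sig φ₁ →
      S₂.M (f x) (f y) * S₂.M (f y) (f x) = S₁.M x y * S₁.M y x := fun {x} hx {y} hy =>
    (dH_eq_iff hφ₁ hs₁ hφ₂ hs₂ hx.1 hy.1 (hmaps hx).1 (hmaps hy).1).1 (hiso x hx y hy)
  have hinj : Set.InjOn f (S₁.Sig φ₁) := fun x hx y hy e => by
    have h1 := hM hx hy
    rw [e, M_self hφ₂ hs₂ (hmaps hy).1, one_mul] at h1
    have h2 := eq_smul_of_M_mul_M_eq_one hφ₁ hs₁ hx.1 hy.1 h1.symm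
    have h3 := congrArg φ₁ h2
    rw [map_smul, hx.2, hy.2, smul_eq_mul, mul_one] at h3
    rw [h2, ← h3, one_smul]
  have hmem : ∀ {x}, x ∈ S₁.interiorC → coneExtension S₁ S₂ φ₁ f x ∈ S₂.interiorC :=
    coneExtension_mem hφ₁ hs₁ hφ₂ hs₂ hmaps
  have hnF : ∀ {x}, x ∈ S₁.interiorC → (φ₂ (coneExtension S₁ S₂ φ₁ f x))⁻¹ •
      coneExtension S₁ S₂ φ₁ f x = f ((φ₁ x)⁻¹ • x) :=
    inv_smul_coneExtension hφ₁ hs₁ hφ₂ hs₂ hmaps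
  have hφ₂F : ∀ {x}, x ∈ S₁.interiorC → 0 < φ₂ (coneExtension S₁ S₂ φ₁ f x) :=
    fun hx => hφ₂.pos hs₂ (hmem hx)
  refine ⟨hmem, ?_, ?_, ?_, ?_, ?_⟩
  · intro c hc x hx
    have e : (φ₁ (c • x))⁻¹ • c • x = (φ₁ x)⁻¹ • x := by
      have := hφ₁.pos hs₁ hx
      rw [map_smul, smul_eq_mul]
      match_scalars
      field_simp
    rw [coneExtension, coneExtension, e, M_smul_right hφ₁ hs₁ hu hx hc, smul_smul]
    congr 1
    field_simp
  · intro x hx y hy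
    obtain ⟨r, hr, e⟩ := exists_coneExtension_eq hφ₁ hs₁ hφ₂ hs₂ hmaps hx
    obtain ⟨t, ht, e'⟩ := exists_coneExtension_eq hφ₁ hs₁ hφ₂ hs₂ hmaps hy
    rw [e, e', M_smul_mul_M_smul hφ₂ hs₂ (hmaps (hn hx)).1 (hmaps (hn hy)).1 hr ht,
      hM (hn hx) (hn hy), M_smul_mul_M_smul hφ₁ hs₁ hx hy (inv_pos.2 (hφ₁.pos hs₁ hx))
      (inv_pos.2 (hφ₁.pos hs₁ hy))]
  · intro x hx
    have hfu : coneExtension S₁ S₂ φ₁ f S₁.u = f S₁.u := by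
      have hs : φ₁ S₁.u = 1 := hs₁
      rw [coneExtension, hs, inv_one, one_smul, M_self hφ₁ hs₁ hu,
        M_self hφ₂ hs₂ (hmaps huS).1, div_one, one_smul]
    have h1 := M_pos hφ₂ hs₂ (hmaps huS).1 (hmaps (hn hx)).1
    have h2 := M_pos hφ₁ hs₁ hu hx
    rw [hfu, coneExtension, M_smul_right hφ₂ hs₂ (hmaps huS).1 (hmaps (hn hx)).1
      (div_pos h1 h2), inv_div, div_mul_cancel₀ _ h1.ne']
  · intro x hx y hy
    have hxy := add_mem_interiorC hx (interiorC_subset hy)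
    refine exists_smul_add_smul_of_inv_smul_mem_segment (hφ₂F hx) (hφ₂F hy) (hφ₂F hxy) ?_
    rw [hnF hx, hnF hy, hnF hxy, ← hseg _ (hn hx) _ (hn hy)]
    exact Set.mem_image_of_mem f (inv_smul_mem_segment (hφ₁.pos hs₁ hx) (hφ₁.pos hs₁ hy)
      (hφ₁.pos hs₁ hxy) zero_le_one zero_le_one (by rw [one_smul, one_smul]))
  · intro x hx y hy z hz a b ha hb e
    refine exists_smul_add_smul_of_inv_smul_mem_segment (hφ₁.pos hs₁ hx) (hφ₁.pos hs₁ hy)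
      (hφ₁.pos hs₁ hz) ?_
    have h1 := inv_smul_mem_segment (hφ₂F hx) (hφ₂F hy) (hφ₂F hz) ha hb e
    rw [hnF hx, hnF hy, hnF hz, ← hseg _ (hn hx) _ (hn hy)] at h1
    obtain ⟨w, hw, hwz⟩ := h1
    rwa [← hinj (segment_subset_Sig (hn hx) (hn hy) hw) (hn hz) hwz]

end Extension

section BiPositive

variable {X₁ : Type*} [AddCommGroup X₁] [Module ℝ X₁] {X₂ : Type*} [AddCommGroup X₂] [Module ℝ X₂]
  {S₁ : OrderUnitSpace X₁} {S₂ : OrderUnitSpace X₂}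

lemma M_map_of_biPositive {T : X₁ →ₗ[ℝ] X₂} (hT : ∀ x, T x ∈ S₂.C ↔ x ∈ S₁.C) (x y : X₁) :
    S₂.M (T x) (T y) = S₁.M x y := by
  simp only [M, ← map_smul, ← map_sub, hT]

lemma pos_of_biPositive {φ₁ : X₁ →ₗ[ℝ] ℝ} {φ₂ : X₂ →ₗ[ℝ] ℝ} (hφ₁ : S₁.StrictlyPos φ₁)
    (hs₁ : S₁.IsState φ₁) (hφ₂ : S₂.StrictlyPos φ₂) {T : X₁ →ₗ[ℝ] X₂}
    (hT : ∀ x, T x ∈ S₂.C ↔ x ∈ S₁.C) {x : X₁} (hx : x ∈ S₁.interiorC) : 0 < φ₂ (T x) := by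
  have hxC := interiorC_subset hx
  refine hφ₂ _ ((hT x).2 hxC) fun h0 => ne_zero_of_mem_interiorC hφ₁ hs₁ hx (S₁.salient hxC ?_)
  rw [← hT, map_neg, h0, neg_zero, ← h0]
  exact (hT x).2 hxC

end BiPositive

end OrderUnitSpace

end HilbertGeom

namespace HilbertGeom

open OrderUnitSpace

/-- A map `f : (Σ₁, d_H) → (Σ₂, d_H)` is an isometry that maps line
segments to line segments if and only if it is a projective linear homomorphism, i.e.
there exists a bi-positive linear map `T : X₁ → X₂` such that `f x = T x / φ₂ (T x)`
for all `x ∈ Σ₁`. -/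
theorem isometry_maps_segments_iff_projective_linear
    {X₁ : Type*} [AddCommGroup X₁] [Module ℝ X₁]
    {X₂ : Type*} [AddCommGroup X₂] [Module ℝ X₂]
    (S₁ : OrderUnitSpace X₁) (S₂ : OrderUnitSpace X₂)
    (φ₁ : X₁ →ₗ[ℝ] ℝ) (φ₂ : X₂ →ₗ[ℝ] ℝ)
    (hstate₁ : S₁.IsState φ₁) (hpos₁ : S₁.StrictlyPos φ₁)
    (hstate₂ : S₂.IsState φ₂) (hpos₂ : S₂.StrictlyPos φ₂)
    (f : X₁ → X₂) (hmaps : Set.MapsTo f (S₁.Sig φ₁) (S₂.Sig φ₂)) :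
    ((∀ x ∈ S₁.Sig φ₁, ∀ y ∈ S₁.Sig φ₁, S₂.dH (f x) (f y) = S₁.dH x y) ∧
      (∀ x ∈ S₁.Sig φ₁, ∀ y ∈ S₁.Sig φ₁,
        f '' segment ℝ x y = segment ℝ (f x) (f y))) ↔
    (∃ T : X₁ →ₗ[ℝ] X₂, (∀ x : X₁, T x ∈ S₂.C ↔ x ∈ S₁.C) ∧
      ∀ x ∈ S₁.Sig φ₁, f x = (φ₂ (T x))⁻¹ • T x) := by
  constructor
  · rintro ⟨hiso, hseg⟩
    obtain ⟨T, hT, hTF⟩ := (isConeIsometry_coneExtension hpos₁ hstate₁ hpos₂ hstate₂ hmaps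
      hiso hseg).exists_linearMap hpos₁ hstate₁ hpos₂ hstate₂
    refine ⟨T, hT, fun x hx => ?_⟩
    rw [hTF x hx.1, inv_smul_coneExtension hpos₁ hstate₁ hpos₂ hstate₂ hmaps hx.1, hx.2, inv_one,
      one_smul]
  · rintro ⟨T, hT, hf⟩
    have hTpos : ∀ {x}, x ∈ S₁.interiorC → 0 < φ₂ (T x) :=
      pos_of_biPositive hpos₁ hstate₁ hpos₂ hT
    have hTmem : ∀ {x}, x ∈ S₁.Sig φ₁ → T x ∈ S₂.interiorC := fun {x} hx => by
      have h := smul_mem_interiorC (hTpos hx.1) (hmaps hx).1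
      rwa [hf x hx, smul_inv_smul₀ (hTpos hx.1).ne'] at h
    refine ⟨fun x hx y hy => ?_, fun x hx y hy => Set.Subset.antisymm ?_ ?_⟩
    · rw [dH_eq_iff hpos₁ hstate₁ hpos₂ hstate₂ hx.1 hy.1 (hmaps hx).1 (hmaps hy).1, hf x hx,
        hf y hy, M_smul_mul_M_smul hpos₂ hstate₂ (hTmem hx) (hTmem hy)
        (inv_pos.2 (hTpos hx.1)) (inv_pos.2 (hTpos hy.1)), M_map_of_biPositive hT,
        M_map_of_biPositive hT]
    · rintro _ ⟨z, hz, rfl⟩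
      have hzS := segment_subset_Sig hx hy hz
      obtain ⟨a, b, ha, hb, -, e⟩ := hz
      rw [hf x hx, hf y hy, hf z hzS]
      exact inv_smul_mem_segment (hTpos hx.1) (hTpos hy.1) (hTpos hzS.1) ha hb
        (by rw [← e, map_add, map_smul, map_smul])
    · intro w hw
      have hwS := segment_subset_Sig (hmaps hx) (hmaps hy) hw
      obtain ⟨a, b, ha, hb, -, e⟩ := hw
      rw [hf x hx, hf y hy, smul_smul, smul_smul, ← map_smul, ← map_smul, ← map_add] at e
      set z := (a * (φ₂ (T x))⁻¹) • x + (b * (φ₂ (T y))⁻¹) • y with hz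
      have hx0 := inv_pos.2 (hTpos hx.1)
      have hy0 := inv_pos.2 (hTpos hy.1)
      have hzC : z ∈ S₁.C := add_mem (S₁.smul_mem (mul_nonneg ha hx0.le) (interiorC_subset hx.1))
        (S₁.smul_mem (mul_nonneg hb hy0.le) (interiorC_subset hy.1))
      have hz1 : 0 < φ₁ z := hpos₁ z hzC fun h0 =>
        ne_zero_of_mem_interiorC hpos₂ hstate₂ hwS.1 (by rw [← e, h0, map_zero])
      have hzseg : (φ₁ z)⁻¹ • z ∈ segment ℝ x y := by
        have hx1 : φ₁ x = 1 := hx.2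
        have hy1 : φ₁ y = 1 := hy.2
        have h := inv_smul_mem_segment (φ := φ₁) (x := x) (y := y) (by simp [hx1]) (by simp [hy1])
          hz1 (mul_nonneg ha hx0.le) (mul_nonneg hb hy0.le) hz
        rwa [hx1, hy1, inv_one, one_smul, one_smul] at h
      refine ⟨_, hzseg, ?_⟩
      rw [hf _ (segment_subset_Sig hx hy hzseg), map_smul, e, map_smul, hwS.2, smul_eq_mul,
        mul_one, inv_inv, smul_inv_smul₀ hz1.ne']

end HilbertGeom
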